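/- For each a ∈ ℂ with a ≠ 0, the operator sin(aD) on H(ℂ), given by (Tf)(z) = (f(z + ia) − f(z − ia))/(2i), supports a hypercyclic algebra: there exists an entire function f such that every nonzero element of the non-unital subalgebra generated by f (equivalently, every nonzero P(f) for a nonzero complex polynomial P with P(0) = 0) is hypercyclic for T. -/

import Mathlib

open Set Polynomial

noncomputable section

abbrev Entire : Type := {f : C(ℂ, ℂ) // Differentiable ℂ (⇑f)}

instance : Zero Entire := ⟨⟨0, by rw [ContinuousMap.coe_zero]; exact differentiable_const 0⟩⟩

def Hypercyclic {X : Type*} [TopologicalSpace X] (T : X → X) (x : X) : Prop :=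
  Dense (Set.range fun n : ℕ => T^[n] x)

def polyApply (P : Polynomial ℂ) (f : Entire) : Entire :=
  ⟨⟨fun z => P.eval (f.1 z), by exact (P.differentiable.comp f.2).continuous⟩,
   by exact P.differentiable.comp f.2⟩

def GeneratesHCAlgebra (T : Entire → Entire) (f : Entire) : Prop :=
  ∀ P : Polynomial ℂ, P.coeff 0 = 0 → polyApply P f ≠ 0 → Hypercyclic T (polyApply P f)

def ExpType (a : ℕ → ℂ) : Prop :=
  ∃ M > (0:ℝ), ∃ R > (0:ℝ), ∀ n : ℕ, ‖a n‖ ≤ M * R ^ n / n.factorial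

def IsCompactArc (Γ : Set ℂ) : Prop :=
  ∃ γ : ℝ → ℂ, ContinuousOn γ (Icc 0 1) ∧ InjOn γ (Icc 0 1) ∧ Γ = γ '' Icc 0 1

def StrictlyConvexArc (Γ : Set ℂ) : Prop :=
  IsCompactArc Γ ∧
  ∀ z₁ ∈ Γ, ∀ z₂ ∈ Γ, ∀ u ∈ segment ℝ z₁ z₂ ∩ Γ, ∀ v ∈ segment ℝ z₁ z₂ ∩ Γ,
    ∀ w ∈ segment ℝ z₁ z₂ ∩ Γ, u = v ∨ u = w ∨ v = w



open Filter Topology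

/-- The exponential `z ↦ exp (w z / a)`, an eigenvector of `sin(aD)`. -/
def expFun (a w : ℂ) : C(ℂ, ℂ) := ⟨fun z => Complex.exp (w * (z / a)), by fun_prop⟩

lemma expFun_apply (a w z : ℂ) : expFun a w z = Complex.exp (w * (z / a)) := rfl

lemma expFun_zero (a : ℂ) : expFun a 0 = 1 := by
  ext z; simp [expFun_apply]

lemma expFun_add (a v w : ℂ) : expFun a (v + w) = expFun a v * expFun a w := by
  ext z; simp [expFun_apply, add_mul, Complex.exp_add]

lemma expFun_sum {ι : Type*} (a : ℂ) (s : Finset ι) (w : ι → ℂ) :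
    expFun a (∑ i ∈ s, w i) = ∏ i ∈ s, expFun a (w i) := by
  classical
  induction s using Finset.induction_on with
  | empty => simp [expFun_zero]
  | insert i s hi ih => rw [Finset.sum_insert hi, Finset.prod_insert hi, expFun_add, ih]

lemma expFun_natCast_mul (a w : ℂ) (n : ℕ) : expFun a (n * w) = expFun a w ^ n := by
  simpa using expFun_sum a (Finset.range n) (fun _ => w)

lemma differentiable_expFun (a w : ℂ) : Differentiable ℂ (expFun a w) := by
  change Differentiable ℂ fun z => Complex.exp (w * (z / a))
  fun_prop

/-- The operator `sin(aD)` on continuous functions. -/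
def sinOp (a : ℂ) : C(ℂ, ℂ) →ₗ[ℂ] C(ℂ, ℂ) :=
  (2 * Complex.I)⁻¹ •
    ((ContinuousMap.compRightAlgHom ℂ ℂ ⟨fun z => z + Complex.I * a, by fun_prop⟩).toLinearMap -
      (ContinuousMap.compRightAlgHom ℂ ℂ ⟨fun z => z - Complex.I * a, by fun_prop⟩).toLinearMap)

lemma sinOp_apply (a : ℂ) (f : C(ℂ, ℂ)) (z : ℂ) :
    sinOp a f z = (f (z + Complex.I * a) - f (z - Complex.I * a)) / (2 * Complex.I) := by
  rw [div_eq_inv_mul]; rfl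

lemma continuous_sinOp (a : ℂ) : Continuous (sinOp a) := by
  have h (g : C(ℂ, ℂ)) := ContinuousMap.continuous_precomp (Z := ℂ) g
  exact ((h _).sub (h _)).const_smul _

lemma continuous_sinOp_pow (a : ℂ) (q : ℕ) : Continuous ((sinOp a ^ q : Module.End ℂ C(ℂ, ℂ))) := by
  rw [Module.End.coe_pow]
  exact (continuous_sinOp a).iterate q

lemma sinOp_expFun {a : ℂ} (ha : a ≠ 0) (w : ℂ) :
    sinOp a (expFun a w) = Complex.sin w • expFun a w := by
  ext z
  have h1 : w * ((z + Complex.I * a) / a) = w * (z / a) + w * Complex.I := by field_simp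
  have h2 : w * ((z - Complex.I * a) / a) = w * (z / a) + -w * Complex.I := by field_simp; ring
  rw [sinOp_apply, expFun_apply, expFun_apply, ContinuousMap.smul_apply, expFun_apply, h1, h2,
    Complex.exp_add, Complex.exp_add, Complex.sin, smul_eq_mul]
  field_simp
  linear_combination (Complex.exp (w * Complex.I) - Complex.exp (-(w * Complex.I))) * Complex.I_sq

lemma sinOp_pow_expFun {a : ℂ} (ha : a ≠ 0) (w : ℂ) (q : ℕ) :
    (sinOp a ^ q : Module.End ℂ C(ℂ, ℂ)) (expFun a w) = Complex.sin w ^ q • expFun a w := by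
  induction q with
  | zero => simp
  | succ q ih => rw [pow_succ', Module.End.mul_apply, ih, map_smul, sinOp_expFun ha, smul_smul,
    pow_succ]

/-- Iterates of `sin(aD)` on a power of a linear combination of exponentials. -/
lemma sinOp_pow_sum_pow {a : ℂ} (ha : a ≠ 0) {ι : Type*} [Fintype ι] (c t w : ι → ℂ) (q k : ℕ) :
    (sinOp a ^ q : Module.End ℂ C(ℂ, ℂ)) ((∑ i, (c i * (t i)⁻¹ ^ q) • expFun a (w i)) ^ k) =
      ∑ p : Fin k → ι, ((∏ l, c (p l)) * (Complex.sin (∑ l, w (p l)) / ∏ l, t (p l)) ^ q) •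
        expFun a (∑ l, w (p l)) := by
  rw [Fintype.sum_pow, map_sum]
  refine Finset.sum_congr rfl fun p _ => ?_
  have : ∏ l, (c (p l) * (t (p l))⁻¹ ^ q) • expFun a (w (p l)) =
      (∏ l, (c (p l) * (t (p l))⁻¹ ^ q)) • expFun a (∑ l, w (p l)) := by
    rw [expFun_sum, Finset.prod_smul]
  rw [this, map_smul, sinOp_pow_expFun ha, smul_smul]
  congr 1
  rw [Finset.prod_mul_distrib, Finset.prod_pow, Finset.prod_inv_distrib, div_pow, inv_pow,
    div_eq_mul_inv]
  ring

lemma exists_polynomial_aeval_mem {g : C(ℂ, ℂ)} (hg : Differentiable ℂ g) {U : Set C(ℂ, ℂ)}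
    (hU : U ∈ 𝓝 g) : ∃ p : ℂ[X], aeval (ContinuousMap.id ℂ) p ∈ U := by
  have h := (hg.hasFPowerSeriesOnBall 0 (R := 1) one_pos).tendstoLocallyUniformlyOn'
  set s := cauchyPowerSeries g 0 ((1 : NNReal) : ℝ)
  rw [show Metric.eball (0 : ℂ) ⊤ = univ by simp,
    tendstoLocallyUniformlyOn_univ] at h
  let P (n : ℕ) : ℂ[X] := ∑ k ∈ Finset.range n, Polynomial.monomial k (s.coeff k)
  have key : Tendsto (fun n => aeval (ContinuousMap.id ℂ) (P n)) atTop (𝓝 g) := by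
    refine ContinuousMap.tendsto_of_tendstoLocallyUniformly (h.congr fun n z => ?_)
    simp only [FormalMultilinearSeries.partialSum, P, map_sum, Polynomial.aeval_monomial,
      ContinuousMap.sum_apply, sub_zero, FormalMultilinearSeries.apply_eq_pow_smul_coeff]
    refine Finset.sum_congr rfl fun k _ => ?_
    simp [mul_comm]
  obtain ⟨n, hn⟩ := (key.eventually hU).exists
  exact ⟨P n, hn⟩

lemma exists_polynomial_aeval_mul_expFun_mem {a : ℂ} (ha : a ≠ 0) (v : ℂ) {g : C(ℂ, ℂ)}
    (hg : Differentiable ℂ g) {U : Set C(ℂ, ℂ)} (hU : U ∈ 𝓝 g) :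
    ∃ p : ℂ[X], aeval (⟨fun z => z / a, by fun_prop⟩ : C(ℂ, ℂ)) p * expFun a v ∈ U := by
  let ψ : C(ℂ, ℂ) → C(ℂ, ℂ) := fun F => F.comp ⟨fun z => z / a, by fun_prop⟩ * expFun a v
  have hψ : Continuous ψ := (ContinuousMap.continuous_precomp _).mul continuous_const
  let G : C(ℂ, ℂ) := ⟨fun z => g (a * z) * Complex.exp (-(v * z)), by fun_prop⟩
  have hG : Differentiable ℂ G := by
    change Differentiable ℂ fun z => g (a * z) * Complex.exp (-(v * z))
    fun_prop
  have hψG : ψ G = g := by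
    ext z
    change g (a * (z / a)) * Complex.exp (-(v * (z / a))) * Complex.exp (v * (z / a)) = g z
    rw [mul_assoc, ← Complex.exp_add, mul_div_cancel₀ _ ha]
    simp
  obtain ⟨p, hp⟩ := exists_polynomial_aeval_mem hG (hψ.continuousAt.preimage_mem_nhds
    (by rwa [hψG]))
  refine ⟨p, ?_⟩
  have : ψ (aeval (ContinuousMap.id ℂ) p) =
      aeval (⟨fun z => z / a, by fun_prop⟩ : C(ℂ, ℂ)) p * expFun a v := by
    have := Polynomial.aeval_algHom_apply (ContinuousMap.compRightAlgHom ℂ ℂ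
      (⟨fun z => z / a, by fun_prop⟩ : C(ℂ, ℂ))) (ContinuousMap.id ℂ) p
    exact congrArg (· * expFun a v) this.symm
  rwa [mem_preimage, this] at hp

lemma tendsto_expFun_sub_one_div (a : ℂ) :
    Tendsto (fun h : ℝ => ((h : ℂ)⁻¹) • (expFun a h - 1)) (𝓝[>] 0)
      (𝓝 ⟨fun z => z / a, by fun_prop⟩) := by
  have hd : Continuous (dslope Complex.exp 0) := by
    rw [← continuousOn_univ, continuousOn_dslope univ_mem]
    exact ⟨Complex.continuous_exp.continuousOn, Complex.differentiable_exp _⟩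
  let Q : C(ℝ × ℂ, ℂ) := ⟨fun x => x.2 / a * dslope Complex.exp 0 (x.1 * (x.2 / a)), by fun_prop⟩
  have hQ := (Q.curry.continuous.tendsto 0).mono_left (nhdsWithin_le_nhds (s := Ioi 0))
  have h0 : Q.curry 0 = ⟨fun z => z / a, by fun_prop⟩ := by
    ext z; simp [Q]
  rw [h0] at hQ
  refine hQ.congr' ?_
  filter_upwards [self_mem_nhdsWithin] with h hh
  have hh' : (h : ℂ) ≠ 0 := by exact_mod_cast (ne_of_gt hh)
  ext z
  have := sub_smul_dslope Complex.exp 0 (h * (z / a))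
  simp only [sub_zero, smul_eq_mul, Complex.exp_zero] at this
  change z / a * dslope Complex.exp 0 (h * (z / a)) = (h : ℂ)⁻¹ * (Complex.exp (h * (z / a)) - 1)
  rw [← this]
  field_simp

/-- Entire functions are limits of combinations of exponentials with frequencies in arithmetic
progressions of small step. -/
lemma eventually_exists_sum_expFun_mem {a : ℂ} (ha : a ≠ 0) (v : ℂ) {g : C(ℂ, ℂ)}
    (hg : Differentiable ℂ g) {U : Set C(ℂ, ℂ)} (hU : U ∈ 𝓝 g) :
    ∃ N : ℕ, ∀ᶠ h : ℝ in 𝓝[>] 0, ∃ b : Fin N → ℂ,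
      ∑ j : Fin N, b j • expFun a (((j * h : ℝ) : ℂ) + v) ∈ U := by
  obtain ⟨p, hp⟩ := exists_polynomial_aeval_mul_expFun_mem ha v hg (interior_mem_nhds.2 hU)
  refine ⟨p.natDegree + 1, ?_⟩
  have h1 : Tendsto (fun h : ℝ => aeval (((h : ℂ)⁻¹) • (expFun a h - 1)) p * expFun a v) (𝓝[>] 0)
      (𝓝 (aeval (⟨fun z => z / a, by fun_prop⟩ : C(ℂ, ℂ)) p * expFun a v)) :=
    ((p.continuous_aeval.tendsto _).comp (tendsto_expFun_sub_one_div a)).mul_const _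
  filter_upwards [h1.eventually (isOpen_interior.mem_nhds hp)] with h hh
  let r : ℂ[X] := p.comp (Polynomial.C (h : ℂ)⁻¹ * (Polynomial.X - 1))
  have hr : r.natDegree < p.natDegree + 1 := by
    refine Nat.lt_succ_of_le (Polynomial.natDegree_comp_le.trans ?_)
    refine (Nat.mul_le_mul_left _ ?_).trans (mul_one _).le
    refine (Polynomial.natDegree_C_mul_le _ _).trans ?_
    rw [← Polynomial.C_1, Polynomial.natDegree_X_sub_C]
  refine ⟨fun j => r.coeff j, ?_⟩
  have hr' : aeval (((h : ℂ)⁻¹) • (expFun a h - 1)) p = aeval (expFun a h) r := by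
    have h2 : (h : ℂ)⁻¹ • (expFun a h - 1) =
        algebraMap ℂ C(ℂ, ℂ) (h : ℂ)⁻¹ * (expFun a h - 1) := by ext; simp
    rw [h2]
    simp [r, Polynomial.aeval_comp]
  rw [hr', Polynomial.aeval_eq_sum_range' hr, Finset.sum_mul] at hh
  rw [Fin.sum_univ_eq_sum_range
    (fun j => r.coeff j • expFun a (((j * h : ℝ) : ℂ) + v)) (p.natDegree + 1)]
  convert interior_subset hh using 3 with j
  rw [expFun_add, Complex.ofReal_mul, Complex.ofReal_natCast, expFun_natCast_mul, smul_mul_assoc]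

lemma norm_sin_add_mul_I_sq (x y : ℝ) :
    ‖Complex.sin (x + y * Complex.I)‖ ^ 2 = Real.sin x ^ 2 + Real.sinh y ^ 2 := by
  rw [Complex.sin_add_mul_I, ← Complex.normSq_eq_norm_sq, ← Complex.ofReal_sin, ← Complex.ofReal_cos,
    ← Complex.ofReal_cosh, ← Complex.ofReal_sinh, ← Complex.ofReal_mul, ← Complex.ofReal_mul,
    Complex.normSq_add_mul_I, mul_pow, mul_pow, Real.cosh_sq, Real.cos_sq']
  ring

lemma one_lt_norm_sin_add_mul_I (x : ℝ) {y : ℝ} (hy : 1 < Real.sinh y) :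
    1 < ‖Complex.sin (x + y * Complex.I)‖ := by
  have := norm_sin_add_mul_I_sq x y
  nlinarith [sq_nonneg (Real.sin x), norm_nonneg (Complex.sin (x + y * Complex.I))]

lemma norm_sin_add_mul_I_lt_one {x y z d : ℝ} (hx : |x| ≤ d) (hy : 0 ≤ y) (hyz : y ≤ z)
    (hz : d ^ 2 + Real.sinh z ^ 2 < 1) : ‖Complex.sin (x + y * Complex.I)‖ < 1 := by
  have h1 := norm_sin_add_mul_I_sq x y
  have h2 : Real.sinh y ^ 2 ≤ Real.sinh z ^ 2 :=
    pow_le_pow_left₀ (Real.sinh_nonneg_iff.2 hy) (Real.sinh_le_sinh.2 hyz) 2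
  have h3 : Real.sin x ^ 2 ≤ d ^ 2 := by
    rw [← sq_abs]
    exact pow_le_pow_left₀ (abs_nonneg _) (Real.abs_sin_le_abs.trans hx) 2
  refine lt_of_pow_lt_pow_left₀ 2 zero_le_one ?_
  linarith

/-- The logarithm of `|sin|` is strictly convex on suitable horizontal segments. -/
lemma strictConvexOn_log_sin_sq_add {s : ℝ} (hs : 1 < s) :
    StrictConvexOn ℝ (Icc (-(1 / 2)) (1 / 2)) fun x => Real.log (Real.sin x ^ 2 + s) := by
  have hpos (x : ℝ) : 0 < Real.sin x ^ 2 + s := by positivity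
  have hd (x : ℝ) : HasDerivAt (fun x => Real.log (Real.sin x ^ 2 + s))
      (2 * Real.sin x * Real.cos x / (Real.sin x ^ 2 + s)) x := by
    simpa using (((Real.hasDerivAt_sin x).pow 2).add_const s).log (hpos x).ne'
  refine strictConvexOn_of_deriv2_pos (convex_Icc _ _)
    (fun x _ => (hd x).continuousAt.continuousWithinAt) fun x hx => ?_
  rw [interior_Icc] at hx
  have hd' : deriv (fun x => Real.log (Real.sin x ^ 2 + s)) =
      fun x => 2 * Real.sin x * Real.cos x / (Real.sin x ^ 2 + s) := funext fun x => (hd x).deriv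
  have h2 : HasDerivAt (fun x => 2 * Real.sin x * Real.cos x / (Real.sin x ^ 2 + s)) _ x :=
    ((((Real.hasDerivAt_sin x).const_mul 2).mul (Real.hasDerivAt_cos x)).div
    (((Real.hasDerivAt_sin x).pow 2).add_const s) (hpos x).ne')
  rw [Function.iterate_succ_apply, Function.iterate_one, hd', HasDerivAt.deriv h2]
  refine div_pos ?_ (by have := hpos x; positivity)
  have hsin : Real.sin x ^ 2 ≤ 1 / 4 := by
    have h := Real.abs_sin_le_abs (x := x)
    have h' : |x| ≤ 1 / 2 := abs_le.2 ⟨hx.1.le, hx.2.le⟩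
    rw [← sq_abs]
    nlinarith [abs_nonneg (Real.sin x)]
  have hcos := Real.cos_sq' x
  simp
  nlinarith

lemma norm_sin_avg_pow_lt_prod {n : ℕ} {x : Fin n → ℝ} {y : ℝ} (hy : 1 < Real.sinh y)
    (hx : ∀ l, |x l| ≤ 1 / 2) (hne : ∃ j k, x j ≠ x k) :
    ‖Complex.sin ((∑ l, x l / n : ℝ) + y * Complex.I)‖ ^ n <
      ∏ l, ‖Complex.sin (x l + y * Complex.I)‖ := by
  obtain ⟨j, k, hjk⟩ := hne
  have hn : 0 < (n : ℝ) := by exact_mod_cast j.pos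
  have hF (t : ℝ) : Real.log (Real.sin t ^ 2 + Real.sinh y ^ 2) =
      2 * Real.log ‖Complex.sin (t + y * Complex.I)‖ := by
    rw [← norm_sin_add_mul_I_sq, Real.log_pow]; norm_cast
  have hpos (t : ℝ) : 0 < ‖Complex.sin (t + y * Complex.I)‖ :=
    one_pos.trans (one_lt_norm_sin_add_mul_I t hy)
  have key := (strictConvexOn_log_sin_sq_add (s := Real.sinh y ^ 2) (by nlinarith)).map_sum_lt
    (t := Finset.univ) (w := fun _ : Fin n => (n : ℝ)⁻¹) (p := x) (fun _ _ => by positivity)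
    (by simp [hn.ne']) (fun l _ => abs_le.1 (hx l))
    ⟨j, Finset.mem_univ _, k, Finset.mem_univ _, hjk⟩
  simp only [hF, smul_eq_mul] at key
  rw [← Real.log_lt_log_iff (pow_pos (hpos _) _) (Finset.prod_pos fun l _ => hpos _), Real.log_pow,
    Real.log_prod (fun l _ => (hpos _).ne')]
  rw [← Finset.mul_sum, ← Finset.mul_sum, ← Finset.mul_sum] at key
  rw [← Finset.sum_div, div_eq_inv_mul]
  rw [lt_inv_mul_iff₀ hn] at key
  linarith

lemma tendsto_const_mul_pow_smul {r : ℂ} (hr : ‖r‖ < 1) (c : ℂ) (f : C(ℂ, ℂ)) :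
    Tendsto (fun q : ℕ => (c * r ^ q) • f) atTop (𝓝 0) := by
  have h1 : Tendsto (fun q : ℕ => c * r ^ q) atTop (𝓝 0) := by
    simpa using (tendsto_pow_atTop_nhds_zero_of_norm_lt_one hr).const_mul c
  have h2 : Continuous fun s : ℂ => s • f := continuous_id.smul continuous_const
  have h3 : (0 : ℂ) • f = 0 := by ext; simp
  rw [← h3]
  exact (h2.tendsto 0).comp h1

section Letters

variable {α β : Type*}

/-- The frequencies `u i` and `(x j + y i) / M`. -/
def letterFreq (M : ℕ) (y : ℝ) (u : α → ℝ) (x : β → ℝ) : α ⊕ β → ℂ :=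
  Sum.elim (fun i => (u i : ℂ)) (fun j => ((x j : ℂ) + y * Complex.I) / M)

lemma norm_sin_sum_letterFreq_div_lt_one {M : ℕ} (hM : 0 < M) {d y : ℝ} (hd : d ≤ 1 / 2)
    (hy : 1 < Real.sinh y) (hz : d ^ 2 + Real.sinh ((M - 1) / M * y) ^ 2 < 1) {u : α → ℝ}
    {x : β → ℝ} (hu : ∀ i, |u i| ≤ d / M) (hx : ∀ j, |x j| ≤ d)
    (hxi : Function.Injective x) {t : α ⊕ β → ℂ} (ht : ∀ i, t (.inl i) = 1)
    (ht' : ∀ j, t (.inr j) ^ M = Complex.sin (x j + y * Complex.I)) {k : ℕ} (hk0 : 0 < k)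
    (hk : k ≤ M) (p : Fin k → α ⊕ β) (hp : k = M → ∀ j, p ≠ fun _ => .inr j) :
    ‖Complex.sin (∑ l, letterFreq M y u x (p l)) / ∏ l, t (p l)‖ < 1 := by
  have hM' : (0 : ℝ) < M := by exact_mod_cast hM
  have hy0 : 0 < y := Real.sinh_pos_iff.1 (one_pos.trans hy)
  have ht1 (i : α ⊕ β) : 1 ≤ ‖t i‖ := by
    rcases i with i | j
    · simp [ht]
    · refine (one_le_pow_iff_of_nonneg (norm_nonneg _) hM.ne').1 ?_
      rw [← norm_pow, ht']
      exact (one_lt_norm_sin_add_mul_I _ hy).le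
  have hT : 1 ≤ ‖∏ l, t (p l)‖ := by
    rw [norm_prod]
    exact Finset.prod_induction _ (1 ≤ ·) (fun _ _ => one_le_mul_of_one_le_of_one_le) le_rfl
      fun l _ => ht1 _
  rw [norm_div, div_lt_one (one_pos.trans_le hT)]
  by_cases hall : k = M ∧ ∀ l, ∃ j, p l = .inr j
  · obtain ⟨rfl, hall⟩ := hall
    choose v hv using hall
    have hne : ∃ j l, x (v j) ≠ x (v l) := by
      by_contra! h
      refine hp rfl (v ⟨0, hM⟩) (funext fun l => ?_)
      rw [hv, hxi (h l ⟨0, hM⟩)]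
    have key := norm_sin_avg_pow_lt_prod (x := fun l => x (v l)) hy
      (fun l => (hx _).trans hd) hne
    have hsum : ∑ l, letterFreq k y u x (p l) =
        ((∑ l, x (v l) / k : ℝ) : ℂ) + y * Complex.I := by
      have : (k : ℂ) ≠ 0 := by exact_mod_cast hM.ne'
      simp only [hv, letterFreq, Sum.elim_inr, add_div, Finset.sum_add_distrib, Finset.sum_const,
        Finset.card_univ, Fintype.card_fin, nsmul_eq_mul]
      push_cast
      field_simp
    rw [hsum]
    refine lt_of_pow_lt_pow_left₀ k (norm_nonneg _) ?_
    rw [norm_prod, ← Finset.prod_pow]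
    simpa only [hv, ← norm_pow, ht'] using key
  · refine lt_of_lt_of_le ?_ hT
    let e : α ⊕ β → ℕ := Sum.elim (fun _ => 0) (fun _ => 1)
    let r : α ⊕ β → ℝ := Sum.elim u (fun j => x j / M)
    have he (i : α ⊕ β) : e i ≤ 1 := by rcases i with i | j <;> simp [e]
    have hr (i : α ⊕ β) : |r i| ≤ d / M := by
      rcases i with i | j
      · exact hu i
      · simp only [r, Sum.elim_inr, abs_div, Nat.abs_cast]
        gcongr
        exact hx j
    have hfreq (i : α ⊕ β) : letterFreq M y u x i = r i + ((e i / M * y : ℝ) : ℂ) * Complex.I := by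
      rcases i with i | j <;> simp [letterFreq, e, r]
      ring
    have hsum : ∑ l, letterFreq M y u x (p l) = ((∑ l, r (p l) : ℝ) : ℂ) +
        (((∑ l, e (p l) : ℕ) / M * y : ℝ) : ℂ) * Complex.I := by
      simp only [hfreq, Finset.sum_add_distrib, ← Finset.sum_mul, ← Complex.ofReal_sum,
        ← Finset.sum_div, Nat.cast_sum]
    have hs : ∑ l, e (p l) < M := by
      have hle : ∑ l, e (p l) ≤ k := by
        simpa using Finset.sum_le_card_nsmul Finset.univ (fun l => e (p l)) 1 fun l _ => he _
      rcases hk.lt_or_eq with hk | rfl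
      · exact hle.trans_lt hk
      · push Not at hall
        obtain ⟨l, hl⟩ := hall rfl
        have : ∑ l, e (p l) < ∑ l : Fin k, 1 := by
          refine Finset.sum_lt_sum (fun l _ => he _) ⟨l, Finset.mem_univ _, ?_⟩
          rcases h : p l with i | j
          · simp [e]
          · exact absurd h (hl j)
        simpa using this
    have hs' : ((∑ l, e (p l) : ℕ) : ℝ) ≤ M - 1 := by
      have : ((∑ l, e (p l) : ℕ) : ℝ) + 1 ≤ M := by exact_mod_cast hs
      linarith
    rw [hsum]
    refine norm_sin_add_mul_I_lt_one (d := d) ?_ (by positivity) (by gcongr) hz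
    refine (Finset.abs_sum_le_sum_abs _ _).trans ((Finset.sum_le_card_nsmul _ _ _
      fun l _ => hr _).trans ?_)
    have hd0 : 0 ≤ d / M := (abs_nonneg _).trans (hr (p ⟨0, hk0⟩))
    rw [Finset.card_univ, Fintype.card_fin, nsmul_eq_mul]
    calc (k : ℝ) * (d / M) ≤ M * (d / M) := by gcongr
      _ = d := by field_simp

variable [Fintype α] [Fintype β]

/-- Under `sin(aD) ^ q`, the `k`-th power tends to zero if `k < M`, and the `M`-th power tends to
the combination of the exponentials with frequencies `x j + y i`. -/
lemma tendsto_sinOp_pow_sum_pow {a : ℂ} (ha : a ≠ 0) {M : ℕ} (hM : 0 < M) {d y : ℝ}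
    (hd : d ≤ 1 / 2)
    (hy : 1 < Real.sinh y) (hz : d ^ 2 + Real.sinh ((M - 1) / M * y) ^ 2 < 1) {u : α → ℝ}
    {x : β → ℝ} (hu : ∀ i, |u i| ≤ d / M) (hx : ∀ j, |x j| ≤ d)
    (hxi : Function.Injective x) {t : α ⊕ β → ℂ} (ht : ∀ i, t (.inl i) = 1)
    (ht' : ∀ j, t (.inr j) ^ M = Complex.sin (x j + y * Complex.I)) (c : α ⊕ β → ℂ)
    {k : ℕ} (hk0 : 0 < k) (hk : k ≤ M) :
    Tendsto (fun q : ℕ => (sinOp a ^ q : Module.End ℂ C(ℂ, ℂ))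
      ((∑ i, (c i * (t i)⁻¹ ^ q) • expFun a (letterFreq M y u x i)) ^ k)) atTop
      (𝓝 (if k = M then ∑ j, c (.inr j) ^ M • expFun a (x j + y * Complex.I) else 0)) := by
  classical
  let e : β → Fin k → α ⊕ β := fun j _ => .inr j
  let L : (Fin k → α ⊕ β) → C(ℂ, ℂ) := fun p => if k = M ∧ p ∈ range e then
    (∏ l, c (p l)) • expFun a (∑ l, letterFreq M y u x (p l)) else 0
  have hL : ∑ p, L p =
      if k = M then ∑ j, c (.inr j) ^ M • expFun a (x j + y * Complex.I) else 0 := by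
    split_ifs with h
    · subst h
      refine (Fintype.sum_of_injective e (fun j l h => ?_) _ L (fun p hp => ?_) fun j => ?_).symm
      · exact Sum.inr_injective (congrFun h ⟨0, hk0⟩)
      · simp only [L, hp, and_false, if_false]
      · have : (k : ℂ) ≠ 0 := by exact_mod_cast hk0.ne'
        simp only [L, mem_range_self, and_self, if_true]
        simp only [e, letterFreq, Sum.elim_inr, Finset.prod_const, Finset.sum_const,
          Finset.card_univ, Fintype.card_fin, nsmul_eq_mul, mul_div_cancel₀ _ this]
    · simp [L, h]
  rw [← hL]
  simp only [sinOp_pow_sum_pow ha]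
  refine tendsto_finsetSum _ fun p _ => ?_
  by_cases hp : k = M ∧ p ∈ range e
  · have hLp : L p = (∏ l, c (p l)) • expFun a (∑ l, letterFreq M y u x (p l)) := if_pos hp
    rw [hLp]
    obtain ⟨rfl, j, rfl⟩ := hp
    have h1 : Complex.sin (∑ l, letterFreq k y u x (e j l)) / ∏ l, t (e j l) = 1 := by
      have : (k : ℂ) ≠ 0 := by exact_mod_cast hk0.ne'
      simp only [e, letterFreq, Sum.elim_inr, Finset.prod_const, Finset.sum_const,
        Finset.card_univ, Fintype.card_fin, nsmul_eq_mul, mul_div_cancel₀ _ this, ht']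
      refine div_self fun h0 => ?_
      have := one_lt_norm_sin_add_mul_I (x j) hy
      rw [h0, norm_zero] at this
      exact absurd this (by norm_num)
    simp only [h1, one_pow, mul_one]
    exact tendsto_const_nhds
  · have hLp : L p = 0 := if_neg hp
    rw [hLp]
    have hlt := norm_sin_sum_letterFreq_div_lt_one hM hd hy hz hu hx hxi ht ht' hk0 hk p
      fun h j hj => hp ⟨h, j, hj.symm⟩
    exact tendsto_const_mul_pow_smul hlt _ _

lemma tendsto_sum_mul_inv_pow_smul_expFun {a : ℂ} {M : ℕ} (hM : 0 < M) {y : ℝ}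
    (hy : 1 < Real.sinh y) {u : α → ℝ} {x : β → ℝ} {t : α ⊕ β → ℂ} (ht : ∀ i, t (.inl i) = 1)
    (ht' : ∀ j, t (.inr j) ^ M = Complex.sin (x j + y * Complex.I)) (c : α ⊕ β → ℂ) :
    Tendsto (fun q : ℕ => ∑ i, (c i * (t i)⁻¹ ^ q) • expFun a (letterFreq M y u x i)) atTop
      (𝓝 (∑ i, c (.inl i) • expFun a (u i))) := by
  have h1 (j : β) : ‖(t (.inr j))⁻¹‖ < 1 := by
    rw [norm_inv]
    refine inv_lt_one_of_one_lt₀ ((one_lt_pow_iff_of_nonneg (norm_nonneg _) hM.ne').1 ?_)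
    rw [← norm_pow, ht']
    exact one_lt_norm_sin_add_mul_I _ hy
  simp only [Fintype.sum_sum_type, ht, inv_one, one_pow, mul_one]
  have h2 := tendsto_finsetSum Finset.univ fun (j : β) _ =>
    tendsto_const_mul_pow_smul (h1 j) (c (.inr j)) (expFun a (letterFreq M y u x (.inr j)))
  simpa [letterFreq] using h2.const_add (∑ i, c (.inl i) • expFun a (u i))

end Letters

lemma exists_sinh_height {M : ℕ} (hM : 0 < M) :
    ∃ y, 1 < Real.sinh y ∧ Real.sinh ((M - 1) / M * y) ^ 2 < 1 := by
  have hM' : (1 : ℝ) ≤ M := by exact_mod_cast hM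
  have h0 : 0 < Real.arsinh 1 := Real.arsinh_pos_iff.2 one_pos
  have h1 : (0 : ℝ) < 2 * M - 1 := by linarith
  refine ⟨2 * M / (2 * M - 1) * Real.arsinh 1, ?_, ?_⟩
  · calc (1 : ℝ) = Real.sinh (Real.arsinh 1) := (Real.sinh_arsinh 1).symm
      _ < _ := by
        refine Real.sinh_lt_sinh.2 (lt_mul_of_one_lt_left h0 ?_)
        rw [one_lt_div h1]
        linarith
  · have h2 : (M - 1) / M * (2 * M / (2 * M - 1) * Real.arsinh 1) =
        (2 * M - 2) / (2 * M - 1) * Real.arsinh 1 := by field_simp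
    have h3 : 0 ≤ (2 * (M : ℝ) - 2) / (2 * M - 1) := div_nonneg (by linarith) h1.le
    rw [h2]
    refine pow_lt_one₀ (Real.sinh_nonneg_iff.2 (by positivity)) ?_ two_ne_zero
    calc _ < Real.sinh (Real.arsinh 1) := by
          refine Real.sinh_lt_sinh.2 (mul_lt_of_lt_one_left h0 ?_)
          rw [div_lt_one h1]
          linarith
      _ = 1 := Real.sinh_arsinh 1

/-- The topological transitivity property behind the existence of a hypercyclic algebra. -/
lemma exists_mem_sinOp_pow_mem {a : ℂ} (ha : a ≠ 0) (n : ℕ) {f g : C(ℂ, ℂ)}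
    (hf : Differentiable ℂ f) (hg : Differentiable ℂ g) {U : Set C(ℂ, ℂ)} (hU : U ∈ 𝓝 f)
    {O : Set (Fin (n + 1) → C(ℂ, ℂ))} (hO : O ∈ 𝓝 (Pi.single (Fin.last n) g)) :
    ∃ F : C(ℂ, ℂ), Differentiable ℂ F ∧ F ∈ U ∧ ∃ q : ℕ,
      (fun k : Fin (n + 1) => (sinOp a ^ q : Module.End ℂ C(ℂ, ℂ)) (F ^ ((k : ℕ) + 1))) ∈ O := by
  obtain ⟨y, hy, hy'⟩ := exists_sinh_height n.succ_pos
  obtain ⟨d, hd0, hd, hz⟩ : ∃ d : ℝ, 0 < d ∧ d ≤ 1 / 2 ∧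
      d ^ 2 + Real.sinh (((n.succ : ℕ) - 1) / (n.succ : ℕ) * y) ^ 2 < 1 := by
    have h : ∀ᶠ d : ℝ in 𝓝[>] 0,
        d ^ 2 + Real.sinh (((n.succ : ℕ) - 1) / (n.succ : ℕ) * y) ^ 2 < 1 := by
      refine nhdsWithin_le_nhds (ContinuousAt.eventually_lt (by fun_prop) continuousAt_const ?_)
      simpa using hy'
    have h' : ∀ᶠ d : ℝ in 𝓝[>] 0, d ≤ 1 / 2 :=
      nhdsWithin_le_nhds (Iic_mem_nhds (by norm_num))
    obtain ⟨d, h1, h2, h3⟩ := (h.and (h'.and self_mem_nhdsWithin)).exists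
    exact ⟨d, h3, h2, h1⟩
  obtain ⟨A, hA⟩ := eventually_exists_sum_expFun_mem ha 0 hf (interior_mem_nhds.2 hU)
  obtain ⟨B, hB⟩ := eventually_exists_sum_expFun_mem ha (y * Complex.I) hg
    ((continuous_single (A := fun _ : Fin (n + 1) => C(ℂ, ℂ))
      (Fin.last n)).continuousAt.preimage_mem_nhds (interior_mem_nhds.2 hO))
  have hsmall (N : ℕ) {r : ℝ} (hr : 0 < r) : ∀ᶠ h : ℝ in 𝓝[>] 0, N * h < r := by
    refine nhdsWithin_le_nhds (ContinuousAt.eventually_lt (by fun_prop) continuousAt_const ?_)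
    simpa using hr
  have hdn : 0 < d / (n.succ : ℕ) := by positivity
  obtain ⟨h, ⟨b₁, h₁⟩, ⟨b₂, h₂⟩, hhA, hhB, hh⟩ := (hA.and (hB.and ((hsmall A hdn).and
    ((hsmall B hd0).and self_mem_nhdsWithin)))).exists
  have hh0 : 0 < h := hh
  have hbound {N : ℕ} {r : ℝ} (hN : N * h < r) (i : Fin N) : |(i * h : ℝ)| ≤ r := by
    rw [abs_of_nonneg (by positivity)]
    refine le_trans ?_ hN.le
    gcongr
    exact i.2.le
  have hinj : Function.Injective fun j : Fin B => (j * h : ℝ) := fun i j hij =>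
    Fin.ext (by exact_mod_cast mul_right_cancel₀ hh0.ne' hij)
  choose s hs using fun j : Fin B => IsAlgClosed.exists_pow_nat_eq
    (Complex.sin ((j * h : ℝ) + y * Complex.I)) n.succ_pos
  choose β hβ using fun j : Fin B => IsAlgClosed.exists_pow_nat_eq (b₂ j) n.succ_pos
  let t : Fin A ⊕ Fin B → ℂ := Sum.elim (fun _ => 1) s
  let c : Fin A ⊕ Fin B → ℂ := Sum.elim b₁ β
  let F : ℕ → C(ℂ, ℂ) := fun q => ∑ i, (c i * (t i)⁻¹ ^ q) • expFun a
    (letterFreq n.succ y (fun i : Fin A => (i * h : ℝ)) (fun j : Fin B => (j * h : ℝ)) i)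
  have hF : Tendsto F atTop (𝓝 (∑ i, c (.inl i) • expFun a ((i * h : ℝ) : ℂ))) :=
    tendsto_sum_mul_inv_pow_smul_expFun n.succ_pos hy (fun _ => rfl) hs c
  have hFk : Tendsto (fun q => fun k : Fin (n + 1) =>
      (sinOp a ^ q : Module.End ℂ C(ℂ, ℂ)) (F q ^ ((k : ℕ) + 1))) atTop
      (𝓝 (Pi.single (Fin.last n)
        (∑ j : Fin B, b₂ j • expFun a (((j * h : ℝ) : ℂ) + y * Complex.I)))) := by
    rw [tendsto_pi_nhds]
    intro k
    have := tendsto_sinOp_pow_sum_pow ha n.succ_pos hd hy hz (hbound hhA) (hbound hhB) hinj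
      (t := t) (fun _ => rfl) hs c k.1.succ_pos (Nat.succ_le_of_lt k.2)
    convert this using 2
    rw [Pi.single_apply]
    simp [c, hβ, Fin.ext_iff]
  simp only [add_zero] at h₁
  obtain ⟨q, hq₁, hq₂⟩ := ((hF.eventually (isOpen_interior.mem_nhds h₁)).and
    (hFk.eventually (isOpen_interior.mem_nhds h₂))).exists
  refine ⟨F q, ?_, interior_subset hq₁, q, interior_subset hq₂⟩
  have : (F q : ℂ → ℂ) = fun z => ∑ i, (c i * (t i)⁻¹ ^ q) * expFun a (letterFreq n.succ y
      (fun i : Fin A => (i * h : ℝ)) (fun j : Fin B => (j * h : ℝ)) i) z := by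
    ext z; simp [F]
  rw [this]
  exact Differentiable.fun_sum fun i _ => (differentiable_expFun a _).const_mul _

lemma isClosed_setOf_differentiable : IsClosed {f : C(ℂ, ℂ) | Differentiable ℂ f} := by
  refine isClosed_of_closure_subset fun f hf => ?_
  obtain ⟨u, hu, hlim⟩ := mem_closure_iff_seq_limit.1 hf
  rw [ContinuousMap.tendsto_iff_tendstoLocallyUniformly, ← tendstoLocallyUniformlyOn_univ] at hlim
  exact differentiableOn_univ.1 (hlim.differentiableOn
    (Eventually.of_forall fun n => (hu n).differentiableOn) isOpen_univ)

instance : BaireSpace Entire :=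
  haveI : TopologicalSpace.IsCompletelyMetrizableSpace Entire :=
    isClosed_setOf_differentiable.isCompletelyMetrizableSpace
  inferInstance

/-- For a generic entire function `f`, the powers `f, …, f ^ (n + 1)` have joint orbits
accumulating at `(0, …, 0, g)` for every entire `g`. -/
lemma exists_entire_forall_single_mem_closure {a : ℂ} (ha : a ≠ 0) :
    ∃ f : Entire, f ≠ 0 ∧ ∀ (n : ℕ) (g : Entire), Pi.single (Fin.last n) g.1 ∈ closure (range
      fun (q : ℕ) (k : Fin (n + 1)) =>
        (sinOp a ^ q : Module.End ℂ C(ℂ, ℂ)) (f.1 ^ ((k : ℕ) + 1))) := by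
  let H (n q : ℕ) (f : Entire) : Fin (n + 1) → C(ℂ, ℂ) :=
    fun k => (sinOp a ^ q : Module.End ℂ C(ℂ, ℂ)) (f.1 ^ ((k : ℕ) + 1))
  have hH (n q : ℕ) : Continuous (H n q) :=
    continuous_pi fun k => (continuous_sinOp_pow a q).comp (continuous_subtype_val.pow _)
  let S : Set (Σ n : ℕ, Set (Fin (n + 1) → C(ℂ, ℂ))) :=
    {s | s.2 ∈ TopologicalSpace.countableBasis _ ∧ ∃ g : Entire, Pi.single (Fin.last s.1) g.1 ∈ s.2}
  have hS : S.Countable := by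
    have h (n : ℕ) : (Sigma.mk (β := fun n : ℕ => Set (Fin (n + 1) → C(ℂ, ℂ))) n ''
        TopologicalSpace.countableBasis (Fin (n + 1) → C(ℂ, ℂ))).Countable :=
      (TopologicalSpace.countable_countableBasis _).image _
    refine (countable_iUnion h).mono fun s hs => ?_
    exact mem_iUnion.2 ⟨s.1, s.2, hs.1, rfl⟩
  have hdense : Dense (⋂ s ∈ S, ⋃ q, H s.1 q ⁻¹' s.2) := by
    refine dense_biInter_of_isOpen (fun s hs => isOpen_iUnion fun q =>
      (TopologicalSpace.isOpen_of_mem_countableBasis hs.1).preimage (hH _ q)) hS fun s hs => ?_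
    obtain ⟨hb, g, hg⟩ := hs
    rw [dense_iff_inter_open]
    rintro V hV ⟨f, hf⟩
    obtain ⟨U, hU, rfl⟩ := isOpen_induced_iff.1 hV
    obtain ⟨F, hF, hFU, q, hq⟩ := exists_mem_sinOp_pow_mem ha s.1 f.2 g.2 (hU.mem_nhds hf)
      ((TopologicalSpace.isOpen_of_mem_countableBasis hb).mem_nhds hg)
    exact ⟨⟨F, hF⟩, hFU, mem_iUnion.2 ⟨q, hq⟩⟩
  obtain ⟨f, hf0, hf⟩ := hdense.inter_open_nonempty {0}ᶜ isOpen_compl_singleton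
    ⟨⟨1, differentiable_const 1⟩, fun h => by
      have := congrArg (fun f : Entire => f.1 0) h
      exact one_ne_zero this⟩
  refine ⟨f, hf0, fun n g => ?_⟩
  rw [(TopologicalSpace.isBasis_countableBasis _).mem_closure_iff]
  intro O hO hgO
  obtain ⟨q, hq⟩ := mem_iUnion.1 (mem_iInter₂.1 hf ⟨n, O⟩ ⟨hO, g, hgO⟩)
  exact ⟨_, hq, q, rfl⟩

/-- For `a ≠ 0`, the operator `sin(aD)`, given by
`(Tf)(z) = (f(z + ia) − f(z − ia))/(2i)`, supports a hypercyclic algebra on `H(ℂ)`. -/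
theorem stmt7 (a : ℂ) (ha : a ≠ 0) (T : Entire → Entire)
    (hT : ∀ (f : Entire) (z : ℂ),
      (T f).1 z = (f.1 (z + Complex.I * a) - f.1 (z - Complex.I * a)) / (2 * Complex.I)) :
    ∃ f : Entire, f ≠ 0 ∧ GeneratesHCAlgebra T f := by
  obtain ⟨f, hf0, hf⟩ := exists_entire_forall_single_mem_closure ha
  refine ⟨f, hf0, fun P hP0 hPf => ?_⟩
  have hiter (q : ℕ) (g : Entire) :
      (T^[q] g).1 = (sinOp a ^ q : Module.End ℂ C(ℂ, ℂ)) g.1 := by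
    have hsemi : Function.Semiconj (Subtype.val : Entire → C(ℂ, ℂ)) T (sinOp a) := fun g => by
      ext z
      rw [hT, sinOp_apply]
    rw [Module.End.pow_apply]
    exact hsemi.iterate_right q g
  have hP : P.natDegree ≠ 0 := by
    intro h
    rw [Polynomial.eq_C_of_natDegree_eq_zero h, hP0] at hPf
    refine hPf (Subtype.ext (ContinuousMap.ext fun z => ?_))
    change Polynomial.eval _ (Polynomial.C 0) = (0 : ℂ)
    simp
  obtain ⟨n, hn⟩ := Nat.exists_eq_succ_of_ne_zero hP
  have hlead : P.coeff (n + 1) ≠ 0 := by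
    rw [← Nat.succ_eq_add_one, ← hn, Polynomial.coeff_natDegree, Polynomial.leadingCoeff_ne_zero]
    rintro rfl
    exact hP Polynomial.natDegree_zero
  have hpoly : (polyApply P f).1 =
      ∑ k : Fin (n + 1), P.coeff ((k : ℕ) + 1) • f.1 ^ ((k : ℕ) + 1) := by
    ext z
    change P.eval (f.1 z) = _
    rw [Polynomial.eval_eq_sum_range, hn, Finset.sum_range_succ', hP0,
      Fin.sum_univ_eq_sum_range (fun k => P.coeff (k + 1) • f.1 ^ (k + 1)) (n + 1)]
    simp
  let Λ : (Fin (n + 1) → C(ℂ, ℂ)) → C(ℂ, ℂ) := fun u =>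
    ∑ k : Fin (n + 1), P.coeff ((k : ℕ) + 1) • u k
  have hΛ : Continuous Λ := by fun_prop
  intro g
  let g' : Entire := ⟨(P.coeff (n + 1))⁻¹ • g.1, g.2.const_smul _⟩
  have key := map_mem_closure hΛ (hf n g')
    (t := Subtype.val '' range fun q : ℕ => T^[q] (polyApply P f)) (by
      rintro _ ⟨q, rfl⟩
      refine ⟨_, ⟨q, rfl⟩, ?_⟩
      rw [hiter, hpoly, map_sum]
      simp [Λ])
  have hΛg : Λ (Pi.single (Fin.last n) g'.1) = g.1 := by
    simp only [Λ]
    rw [Finset.sum_eq_single (Fin.last n)]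
    · simp [g', hlead]
    · intro k _ hk
      rw [Pi.single_eq_of_ne hk]
      ext
      simp
    · simp
  rw [hΛg] at key
  rwa [closure_subtype]
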